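/- Suppose G is a 3-connected graph with G ∈ host(K_3), and G' is formed from G by adding an edge xy between two non-adjacent vertices x and y of G. Then G' ∈ host(K_3). -/

import Mathlib

open SimpleGraph

section Defs

variable {V : Type*} {W : Type*}

/-- `f` is an `H`-model of `G`: every branch set (preimage of a label) is nonempty and
connected, and for every edge of `H` there is a connecting edge of `G`. -/
def IsModel (G : SimpleGraph V) (H : SimpleGraph W) (f : V → W) : Prop :=
  (∀ i : W, (f ⁻¹' {i}).Nonempty ∧ (G.induce (f ⁻¹' {i})).Connected) ∧
  ∀ ⦃i j : W⦄, H.Adj i j → ∃ u v : V, G.Adj u v ∧ f u = i ∧ f v = j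

/-- One reconfiguration step: both endpoints are `H`-models and they differ on exactly
one vertex of `G`. -/
def ModelStep (G : SimpleGraph V) (H : SimpleGraph W) (f g : V → W) : Prop :=
  IsModel G H f ∧ IsModel G H g ∧ ∃ v : V, f v ≠ g v ∧ ∀ u : V, u ≠ v → f u = g u

/-- `G` is in `host(H)`: it admits an `H`-model and the reconfiguration graph of
`H`-models of `G` is connected. -/
def InHost (G : SimpleGraph V) (H : SimpleGraph W) : Prop :=
  (∃ f : V → W, IsModel G H f) ∧
  ∀ f g : V → W, IsModel G H f → IsModel G H g →
    Relation.ReflTransGen (ModelStep G H) f g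

/-- `S` is a cut set of `G`: deleting `S` leaves at least two components. -/
def IsCutSet (G : SimpleGraph V) (S : Set V) : Prop :=
  ∃ u w : ↥(Sᶜ), ¬ (G.induce Sᶜ).Reachable u w

/-- `G` is `k`-connected: it has no cut set of fewer than `k` vertices. -/
def KConnected (G : SimpleGraph V) (k : ℕ) : Prop :=
  ∀ S : Set V, S.Finite → S.ncard < k → ¬ IsCutSet G S

/-- `v` is a cut vertex of the subgraph of `G` induced on `A`. -/
def IsCutVertexOf (G : SimpleGraph V) (A : Set V) (v : V) : Prop :=
  v ∈ A ∧ ∃ u w : ↥(A \ {v}), ¬ (G.induce (A \ {v})).Reachable u w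

def NoCutVertexIn (G : SimpleGraph V) (B : Set V) : Prop :=
  ∀ v : V, ¬ IsCutVertexOf G B v

/-- `B` is a block of the subgraph of `G` induced on `A`: a maximal connected subgraph
of it without a cut vertex. -/
def IsBlockOf (G : SimpleGraph V) (A B : Set V) : Prop :=
  B ⊆ A ∧ B.Nonempty ∧ (G.induce B).Connected ∧ NoCutVertexIn G B ∧
  ∀ B' : Set V, B ⊆ B' → B' ⊆ A → (G.induce B').Connected → NoCutVertexIn G B' → B' = B

/-- `B` is a leaf block of the subgraph of `G` induced on `A`: a block containing at
most one joining vertex (cut vertex of the induced subgraph on `A`). -/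
def IsLeafBlockOf (G : SimpleGraph V) (A B : Set V) : Prop :=
  IsBlockOf G A B ∧
  ∀ v w : V, v ∈ B → w ∈ B → IsCutVertexOf G A v → IsCutVertexOf G A w → v = w

/-- `v` is essential for label `b`: `f v` and `b` are adjacent labels of `H` and every
connecting edge between the branch sets of `f v` and of `b` has `v` as an endpoint. -/
def EssentialFor (G : SimpleGraph V) (H : SimpleGraph W) (f : V → W) (v : V) (b : W) : Prop :=
  H.Adj (f v) b ∧ ∀ u w : V, G.Adj u w → f u = f v → f w = b → u = v

/-- `v` is crucial: essential for two distinct labels. -/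
def IsCrucial (G : SimpleGraph V) (H : SimpleGraph W) (f : V → W) (v : V) : Prop :=
  ∃ b c : W, b ≠ c ∧ EssentialFor G H f v b ∧ EssentialFor G H f v c

/-- `v` is `b`-crucial: `v` has a neighbour labeled `b` and is essential for some label
`c ∉ {f v, b}`. -/
def IsBCrucial (G : SimpleGraph V) (H : SimpleGraph W) (f : V → W) (v : V) (b : W) : Prop :=
  (∃ u : V, G.Adj v u ∧ f u = b) ∧
  ∃ c : W, c ≠ f v ∧ c ≠ b ∧ EssentialFor G H f v c

/-- `uv` is the unique (essential) connecting edge between branch sets `a` and `b`. -/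
def IsEssEdge (G : SimpleGraph V) (f : V → W) (a b : W) (u v : V) : Prop :=
  G.Adj u v ∧ f u = a ∧ f v = b ∧
  ∀ u' v' : V, G.Adj u' v' → f u' = a → f v' = b → u' = u ∧ v' = v

/-- The branch sets of labels `a` and `b` are weakly connected. -/
def WeaklyConnected (G : SimpleGraph V) (H : SimpleGraph W) (f : V → W) (a b : W) : Prop :=
  (∃ v : V, f v = a ∧ EssentialFor G H f v b) ∨
  (∃ v : V, f v = b ∧ EssentialFor G H f v a)

/-- `p` is a valid designation of a lynchpin for the weak connection between the branch
sets of `a` and `b`: an endpoint of the essential edge if one exists, and otherwise the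
essential vertex giving rise to the weak connection. -/
def IsLynchpin (G : SimpleGraph V) (H : SimpleGraph W) (f : V → W) (a b : W) (p : V) : Prop :=
  (∃ u v : V, IsEssEdge G f a b u v ∧ (p = u ∨ p = v)) ∨
  ((∀ u v : V, ¬ IsEssEdge G f a b u v) ∧
    ((f p = a ∧ EssentialFor G H f p b) ∨ (f p = b ∧ EssentialFor G H f p a)))

/-- `C` is a connected component of the subgraph of `G` induced on `A`. -/
def IsCompOf (G : SimpleGraph V) (A C : Set V) : Prop :=
  C ⊆ A ∧ C.Nonempty ∧ (G.induce C).Connected ∧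
  ∀ C' : Set V, C ⊆ C' → C' ⊆ A → (G.induce C').Connected → C' = C

/-- One reconfiguration step that changes (the label of) a vertex of `A` only. -/
def ModelStepWithin (G : SimpleGraph V) (H : SimpleGraph W) (A : Set V) (f g : V → W) : Prop :=
  IsModel G H f ∧ IsModel G H g ∧ ∃ v ∈ A, f v ≠ g v ∧ ∀ u : V, u ≠ v → f u = g u

/-- `g` is reachable from `f` by reconfiguration steps changing only vertices of `A`. -/
def ReachWithin (G : SimpleGraph V) (H : SimpleGraph W) (A : Set V) (f g : V → W) : Prop :=
  Relation.ReflTransGen (ModelStepWithin G H A) f g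

/-- `f` is a leaf-crucial model: some crucial vertex is an interior vertex in a leaf
block of its branch set. -/
def LeafCrucialModel (G : SimpleGraph V) (H : SimpleGraph W) (f : V → W) : Prop :=
  ∃ (v : V) (L : Set V), IsLeafBlockOf G (f ⁻¹' {f v}) L ∧ v ∈ L ∧
    ¬ IsCutVertexOf G (f ⁻¹' {f v}) v ∧ IsCrucial G H f v

/-- `f` is a leaf-`b`-crucial model: some `b`-crucial vertex is an interior vertex in a
leaf block of its branch set. -/
def LeafBCrucialModel (G : SimpleGraph V) (H : SimpleGraph W) (f : V → W) (b : W) : Prop :=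
  ∃ (v : V) (L : Set V), IsLeafBlockOf G (f ⁻¹' {f v}) L ∧ v ∈ L ∧
    ¬ IsCutVertexOf G (f ⁻¹' {f v}) v ∧ IsBCrucial G H f v b

/-- `f` hits a leaf-crucial model on relabeling `A`. -/
def HitsLeafCrucial (G : SimpleGraph V) (H : SimpleGraph W) (A : Set V) (f : V → W) : Prop :=
  ∀ g : V → W, ReachWithin G H A f g →
    ∃ h : V → W, ReachWithin G H A g h ∧ LeafCrucialModel G H h

/-- `f` hits a leaf-`b`-crucial model on relabeling `A`. -/
def HitsLeafBCrucial (G : SimpleGraph V) (H : SimpleGraph W) (A : Set V) (f : V → W)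
    (b : W) : Prop :=
  ∀ g : V → W, ReachWithin G H A f g →
    ∃ h : V → W, ReachWithin G H A g h ∧ LeafBCrucialModel G H h b

end Defs

section WalksInside

variable {V : Type*}

/-- `v` is reachable from `u` by a walk of `G` that stays inside `S`. -/
def ReachIn (G : SimpleGraph V) (S : Set V) (u v : V) : Prop :=
  ∃ p : G.Walk u v, ∀ z ∈ p.support, z ∈ S

/-- Any two vertices of `S` are joined by a walk of `G` inside `S`. -/
def ConnIn (G : SimpleGraph V) (S : Set V) : Prop :=
  ∀ ⦃u⦄, u ∈ S → ∀ ⦃v⦄, v ∈ S → ReachIn G S u v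

namespace ReachIn

variable {G G' : SimpleGraph V} {S T : Set V} {u v w : V}

lemma refl (h : u ∈ S) : ReachIn G S u u := ⟨.nil, by simpa using h⟩

lemma left_mem (h : ReachIn G S u v) : u ∈ S := by
  obtain ⟨p, hp⟩ := h
  exact hp _ p.start_mem_support

lemma symm (h : ReachIn G S u v) : ReachIn G S v u := by
  obtain ⟨p, hp⟩ := h
  exact ⟨p.reverse, by simpa using hp⟩

lemma right_mem (h : ReachIn G S u v) : v ∈ S := h.symm.left_mem

lemma trans (h : ReachIn G S u v) (h' : ReachIn G S v w) : ReachIn G S u w := by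
  obtain ⟨p, hp⟩ := h
  obtain ⟨q, hq⟩ := h'
  refine ⟨p.append q, fun z hz => ?_⟩
  rcases (SimpleGraph.Walk.mem_support_append_iff p q).1 hz with hz | hz
  exacts [hp z hz, hq z hz]

lemma of_adj (hu : u ∈ S) (hv : v ∈ S) (h : G.Adj u v) : ReachIn G S u v :=
  ⟨h.toWalk, by simp [hu, hv]⟩

lemma mono (hG : G ≤ G') (hS : S ⊆ T) (h : ReachIn G S u v) : ReachIn G' T u v := by
  obtain ⟨p, hp⟩ := h
  exact ⟨p.mapLe hG, fun z hz => hS (hp z (by simpa using hz))⟩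

/-- A walk inside `S` from a vertex of `K` to a vertex outside `K` leaves `K` by an edge. -/
lemma exists_exit (h : ReachIn G S u v) {K : Set V} (hu : u ∈ K) (hv : v ∉ K) :
    ∃ p ∈ K, ∃ q ∉ K, p ∈ S ∧ q ∈ S ∧ G.Adj p q := by
  obtain ⟨p, hp⟩ := h
  induction p with
  | nil => exact absurd hu hv
  | @cons a b c hab p ih =>
    by_cases hb : b ∈ K
    · exact ih hb hv fun z hz => hp z (by simp [hz])
    · exact ⟨a, hu, b, hb, hp a (by simp), hp b (by simp), hab⟩

/-- Every walk inside `S` starting at `u` stays inside the component of `u` in `S`. -/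
lemma within_component (h : ReachIn G S u v) : ReachIn G {z | ReachIn G S u z} u v := by
  classical
  obtain ⟨p, hp⟩ := h
  exact ⟨p, fun z hz => ⟨p.takeUntil z hz, fun t ht =>
    hp t (p.support_takeUntil_subset_support hz ht)⟩⟩

lemma iff_reachable_induce (hu : u ∈ S) (hv : v ∈ S) :
    ReachIn G S u v ↔ (G.induce S).Reachable ⟨u, hu⟩ ⟨v, hv⟩ := by
  constructor
  · rintro ⟨p, hp⟩
    exact ⟨p.induce S hp⟩
  · rintro ⟨p⟩
    refine ⟨p.map (SimpleGraph.Embedding.induce S).toHom, fun z hz => ?_⟩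
    obtain ⟨t, -, rfl⟩ := List.mem_map.1 ((SimpleGraph.Walk.support_map _ p) ▸ hz)
    exact t.2

end ReachIn

variable {G G' : SimpleGraph V} {S : Set V}

lemma connected_induce_iff_connIn :
    (G.induce S).Connected ↔ S.Nonempty ∧ ConnIn G S := by
  rw [SimpleGraph.connected_iff]
  constructor
  · rintro ⟨h, hn⟩
    exact ⟨Set.nonempty_coe_sort.1 hn, fun u hu v hv =>
      (ReachIn.iff_reachable_induce hu hv).2 (h _ _)⟩
  · rintro ⟨hn, h⟩
    exact ⟨fun u v => (ReachIn.iff_reachable_induce u.2 v.2).1 (h u.2 v.2), hn.to_subtype⟩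

lemma ConnIn.mono (hG : G ≤ G') (h : ConnIn G S) : ConnIn G' S :=
  fun _ hu _ hv => (h hu hv).mono hG subset_rfl

lemma ConnIn.of_forall_reachIn {x : V} (h : ∀ z ∈ S, ReachIn G S x z) : ConnIn G S :=
  fun u hu v hv => (h u hu).symm.trans (h v hv)

lemma ConnIn.insert {v w : V} (h : ConnIn G S) (hw : w ∈ S) (hvw : G.Adj v w) :
    ConnIn G (insert v S) := by
  apply ConnIn.of_forall_reachIn (x := w)
  rintro z (rfl | hz)
  · exact ReachIn.of_adj (by simp [hw]) (by simp) hvw.symm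
  · exact (h hw hz).mono le_rfl (Set.subset_insert _ _)

lemma connIn_component (x : V) : ConnIn G {z | ReachIn G S x z} :=
  ConnIn.of_forall_reachIn fun _ hz => hz.within_component

/-- The first vertex of a set met by a walk. -/
lemma SimpleGraph.Walk.exists_first_mem {x y n : V} (p : G.Walk x y) {N : Set V} (hn : n ∈ N)
    (hnp : n ∈ p.support) :
    ∃ m ∈ N, ∃ q : G.Walk x m, (∀ z ∈ q.support, z ∈ p.support) ∧
      ∀ z ∈ q.support, z ∈ N → z = m := by
  induction p with
  | @nil u =>
    obtain rfl : n = u := by simpa using hnp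
    exact ⟨n, hn, .nil, by simp, by simp⟩
  | @cons a b c hab p ih =>
    by_cases ha : a ∈ N
    · exact ⟨a, ha, .nil, by simp, by simp⟩
    · have hnp' : n ∈ p.support := by
        rcases (by simpa using hnp : n = a ∨ n ∈ p.support) with rfl | h
        exacts [absurd hn ha, h]
      obtain ⟨m, hm, q, hq, hqN⟩ := ih hnp'
      refine ⟨m, hm, .cons hab q, fun z hz => ?_, fun z hz hzN => ?_⟩
      · rcases (by simpa using hz : z = a ∨ z ∈ q.support) with rfl | h
        exacts [by simp, by simp [hq z h]]
      · rcases (by simpa using hz : z = a ∨ z ∈ q.support) with rfl | h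
        exacts [absurd hzN ha, hqN z h hzN]

end WalksInside

section ThreeConnected

variable {V : Type*} {G G' : SimpleGraph V}

lemma KConnected.mono {k : ℕ} (h : KConnected G k) (hG : G ≤ G') : KConnected G' k :=
  fun _ hS hk ⟨u, w, huw⟩ => h _ hS hk ⟨u, w, fun hr => huw (hr.mono fun _ _ hab => hG hab)⟩

variable [Finite V]

lemma KConnected.reachIn_compl {k : ℕ} (h : KConnected G k) {N : Set V} (hN : N.ncard < k)
    {u v : V} (hu : u ∉ N) (hv : v ∉ N) : ReachIn G Nᶜ u v := by
  by_contra hc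
  exact h N N.toFinite hN ⟨⟨u, hu⟩, ⟨v, hv⟩, fun hr =>
    hc ((ReachIn.iff_reachable_induce _ _).2 hr)⟩

/-- In a 3-connected graph, a connected vertex set with at least two vertices and nonempty
complement has, besides any prescribed vertex `x`, a non-separating vertex with a neighbour
outside the set. -/
lemma KConnected.exists_nonseparating (h : KConnected G 3) {A : Set V} (hA : ConnIn G A)
    {x z o : V} (hx : x ∈ A) (hz : z ∈ A) (hzx : z ≠ x) (ho : o ∉ A) :
    ∃ v ∈ A, v ≠ x ∧ ConnIn G (A \ {v}) ∧ ∃ u ∉ A, G.Adj v u := by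
  have hW : {w | w ∈ A ∧ w ≠ x ∧ ∃ u ∉ A, G.Adj w u}.Nonempty := by
    obtain ⟨p, hp, q, hq, hpx, -, hpq⟩ :=
      (h.reachIn_compl (N := {x}) (by simp) (u := z) (v := o) (by simpa using hzx)
        (by rintro rfl; exact ho hx)).exists_exit hz ho
    exact ⟨p, hp, hpx, q, hq, hpq⟩
  obtain ⟨w, ⟨hwA, hwx, hwu⟩, hmax⟩ := Set.exists_max_image _
    (fun w => {k | ReachIn G (A \ {w}) x k}.ncard) (Set.toFinite _) hW
  refine ⟨w, hwA, hwx, ConnIn.of_forall_reachIn (x := x) fun z hz => ?_, hwu⟩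
  by_contra hzx
  obtain ⟨p, hp, q, hq, -, hqw, hpq⟩ :=
    (h.reachIn_compl (N := {w}) (by simp) (u := z) (v := x) hz.2
      (by simpa using hwx.symm)).exists_exit (K := {k | ReachIn G (A \ {w}) z k})
      (ReachIn.refl hz) (fun hc => hzx (ReachIn.symm hc))
  have hp' : ReachIn G (A \ {w}) z p := hp
  have hxp : ¬ ReachIn G (A \ {w}) x p := fun hc => hzx (hc.trans hp'.symm)
  have hqA : q ∉ A := fun hqA =>
    hq (hp'.trans (ReachIn.of_adj hp'.right_mem ⟨hqA, hqw⟩ hpq))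
  have hpA : p ∈ A := hp'.right_mem.1
  have hpw : w ≠ p := fun e => hp'.right_mem.2 e.symm
  have hpx : p ≠ x := by
    rintro rfl
    exact hzx hp'.symm
  have hsub : ∀ k, ReachIn G (A \ {w}) x k → ReachIn G (A \ {p}) x k := fun k hk =>
    hk.within_component.mono le_rfl fun t ht =>
      ⟨(ReachIn.right_mem ht).1, by rintro rfl; exact hxp ht⟩
  obtain ⟨p', hp', q', hq', -, hq'A, hpq'⟩ :=
    (hA hx hwA).exists_exit (K := {k | ReachIn G (A \ {w}) x k})
      (ReachIn.refl ⟨hx, hwx.symm⟩) (fun hc => (ReachIn.right_mem hc).2 rfl)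
  obtain rfl : q' = w := by
    by_contra hne
    exact hq' (ReachIn.trans hp' (ReachIn.of_adj (ReachIn.right_mem hp') ⟨hq'A, hne⟩ hpq'))
  have hlt : {k | ReachIn G (A \ {q'}) x k}.ncard < {k | ReachIn G (A \ {p}) x k}.ncard := by
    refine Set.ncard_lt_ncard ⟨fun k hk => hsub k hk, fun hc => ?_⟩ (Set.toFinite _)
    exact hq' (hc ((hsub _ hp').trans
      (ReachIn.of_adj (hsub _ hp').right_mem ⟨hwA, hpw⟩ hpq')))
  exact absurd (hmax p ⟨hpA, hpx, q, hqA, hpq⟩) (not_le.2 hlt)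

/-- In a 3-connected graph any two vertices `x` and `y` are joined by an induced path whose
complement `D` is connected and dominates the path. The path is given by its vertex set
`Dᶜ`, every vertex of which lies on every walk from `x` to `y` inside it. -/
lemma KConnected.exists_nonseparating_path (h : KConnected G 3) {x y z : V}
    (hzx : z ≠ x) (hzy : z ≠ y) :
    ∃ D : Set V, D.Nonempty ∧ ConnIn G D ∧ ReachIn G Dᶜ x y ∧
      (∀ v ∉ D, ∃ d ∈ D, G.Adj v d) ∧
      ∀ v ∉ D, ∀ p : G.Walk x y, (∀ t ∈ p.support, t ∉ D) → v ∈ p.support := by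
  obtain ⟨D, ⟨hDne, hDc, hDxy⟩, hmax⟩ := Set.exists_max_image
    {D : Set V | D.Nonempty ∧ ConnIn G D ∧ ReachIn G Dᶜ x y} Set.ncard (Set.toFinite _)
    ⟨{z}, by simp, by rintro u rfl v rfl; exact ReachIn.refl rfl,
      h.reachIn_compl (by simp) (by simpa using hzx.symm) (by simpa using hzy.symm)⟩
  have hsep : ∀ v ∉ D, (∃ d ∈ D, G.Adj v d) →
      ∀ p : G.Walk x y, (∀ t ∈ p.support, t ∉ D) → v ∈ p.support := by
    rintro v hv ⟨d, hd, hvd⟩ p hp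
    by_contra hvp
    have := hmax (insert v D) ⟨Set.insert_nonempty _ _, hDc.insert hd hvd, p, fun t ht => by
      rintro (rfl | htD)
      exacts [hvp ht, hp t ht htD]⟩
    rw [Set.ncard_insert_of_notMem hv] at this
    omega
  have hdom : ∀ v ∉ D, ∃ d ∈ D, G.Adj v d := by
    intro v hvD
    by_contra hnd
    let Q : Set V := {t | t ∉ D ∧ ∀ p : G.Walk x y, (∀ t ∈ p.support, t ∉ D) → t ∈ p.support}
    let U : Set V := {t | t ∉ D ∧ (t = v ∨ t ∉ Q)}
    let K : Set V := {t | ReachIn G U v t}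
    let N : Set V := {t | t ∉ K ∧ ∃ k ∈ K, G.Adj k t}
    have hvK : v ∈ K := ReachIn.refl ⟨hvD, Or.inl rfl⟩
    have hKU : K ⊆ U := fun t ht => ReachIn.right_mem ht
    have hND : ∀ t ∈ N, t ∉ D := by
      rintro t ⟨-, k, hk, hkt⟩ htD
      rcases (hKU hk).2 with rfl | hkQ
      · exact hnd ⟨t, htD, hkt⟩
      · exact hkQ ⟨(hKU hk).1, hsep k (hKU hk).1 ⟨t, htD, hkt⟩⟩
    have hNQ : ∀ t ∈ N, t ∈ Q := by
      rintro t ht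
      by_contra htQ
      obtain ⟨htK, k, hk, hkt⟩ := ht
      have htU : t ∈ U := ⟨hND t ⟨htK, k, hk, hkt⟩, Or.inr htQ⟩
      exact htK (ReachIn.trans hk (ReachIn.of_adj (hKU hk) htU hkt))
    have hcard : N.ncard < 3 := by
      rcases N.eq_empty_or_nonempty with hN | ⟨n, hn⟩
      · simp [hN]
      obtain ⟨P, hP⟩ := hDxy
      obtain ⟨m, hm, q, hqP, hqN⟩ := P.exists_first_mem hn ((hNQ n hn).2 P hP)
      obtain ⟨m', hm', q', hqP', hqN'⟩ := P.reverse.exists_first_mem hn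
        (by simpa using (hNQ n hn).2 P hP)
      obtain ⟨-, k, hk, hkm⟩ := id hm
      obtain ⟨-, k', hk', hkm'⟩ := id hm'
      obtain ⟨r, hr⟩ := connIn_component (G := G) (S := U) v hk hk'
      have hsub : N ⊆ {m, m'} := by
        intro t ht
        have htw := (hNQ t ht).2
          (((q.concat hkm.symm).append r).append ((q'.concat hkm'.symm).reverse)) (by
            intro s hs
            simp only [SimpleGraph.Walk.mem_support_append_iff, SimpleGraph.Walk.support_reverse,
              List.mem_reverse, SimpleGraph.Walk.support_concat,
              List.mem_append, List.mem_singleton] at hs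
            rcases hs with ((hs | rfl) | hs) | hs | rfl
            · exact hP s (hqP s hs)
            · exact (hKU hk).1
            · exact (hKU (hr s hs)).1
            · exact hP s (by simpa using hqP' s hs)
            · exact (hKU hk').1)
        simp only [SimpleGraph.Walk.mem_support_append_iff, SimpleGraph.Walk.support_reverse,
          List.mem_reverse, SimpleGraph.Walk.support_concat,
          List.mem_append, List.mem_singleton] at htw
        rcases htw with ((hs | rfl) | hs) | hs | rfl
        · exact Or.inl (hqN t hs ht)
        · exact absurd hk ht.1
        · exact absurd (hr t hs) ht.1
        · exact Or.inr (hqN' t hs ht)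
        · exact absurd hk' ht.1
      have h1 := Set.ncard_le_ncard hsub (Set.toFinite _)
      have h2 := Set.ncard_insert_le m {m'}
      rw [Set.ncard_singleton] at h2
      omega
    obtain ⟨d, hd⟩ := hDne
    obtain ⟨p, hp, q, hq, -, hqN, hpq⟩ :=
      (h.reachIn_compl hcard (u := v) (v := d) (fun hc => hc.1 hvK)
        (fun hc => hND d hc hd)).exists_exit hvK (fun hc => (hKU hc).1 hd)
    exact hqN ⟨hq, p, hp, hpq⟩
  exact ⟨D, hDne, hDc, hDxy, hdom, fun v hv => hsep v hv (hdom v hv)⟩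

end ThreeConnected

section Reconfiguration

variable {V W : Type*} {G G' : SimpleGraph V} {H : SimpleGraph W}

lemma isModel_iff {f : V → W} : IsModel G H f ↔
    (∀ i, (∃ v, f v = i) ∧ ConnIn G {z | f z = i}) ∧
      ∀ i j, H.Adj i j → ∃ u v, G.Adj u v ∧ f u = i ∧ f v = j := by
  refine and_congr (forall_congr' fun i => ?_) Iff.rfl
  rw [connected_induce_iff_connIn]
  exact ⟨fun h => ⟨h.1, h.2.2⟩, fun h => ⟨h.1, h.1, h.2⟩⟩

lemma IsModel.mono {f : V → W} (hG : G ≤ G') (h : IsModel G H f) : IsModel G' H f := by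
  rw [isModel_iff] at h ⊢
  refine ⟨fun i => ⟨(h.1 i).1, (h.1 i).2.mono hG⟩, fun i j hij => ?_⟩
  obtain ⟨u, v, huv, h'⟩ := h.2 i j hij
  exact ⟨u, v, hG huv, h'⟩

lemma ModelStep.mono {f g : V → W} (hG : G ≤ G') (h : ModelStep G H f g) :
    ModelStep G' H f g := ⟨h.1.mono hG, h.2.1.mono hG, h.2.2⟩

lemma ModelStep.symm {f g : V → W} (h : ModelStep G H f g) : ModelStep G H g f := by
  obtain ⟨hf, hg, v, hv, hu⟩ := h
  exact ⟨hg, hf, v, hv.symm, fun u hne => (hu u hne).symm⟩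

lemma reflTransGen_modelStep_symm {f g : V → W} (h : Relation.ReflTransGen (ModelStep G H) f g) :
    Relation.ReflTransGen (ModelStep G H) g f :=
  Relation.reflTransGen_swap.1 (Relation.ReflTransGen.mono (fun _ _ => ModelStep.symm) _ _ h)

/-- Giving a vertex `v` the label of its neighbour `w` is a reconfiguration step if the rest of
the branch set of `v` is connected and meets the other branch sets. -/
lemma IsModel.modelStep_update [DecidableEq V] {f : V → W} (hf : IsModel G ⊤ f) {v w : V}
    (hvw : G.Adj v w) (hlab : f w ≠ f v) (hne : ∃ z, f z = f v ∧ z ≠ v)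
    (hc : ConnIn G {z | f z = f v ∧ z ≠ v})
    (hadj : ∀ l, l ≠ f v → l ≠ f w → ∃ s t, G.Adj s t ∧ f s = f v ∧ s ≠ v ∧ f t = l) :
    ModelStep G ⊤ f (Function.update f v (f w)) := by
  refine ⟨hf, ?_, v, by simpa using hlab.symm, fun u hu => by simp [hu]⟩
  rw [isModel_iff] at hf ⊢
  have hwv : w ≠ v := hvw.ne'
  refine ⟨fun i => ?_, ?_⟩
  · by_cases hi : i = f v
    · subst hi
      have he : {z | Function.update f v (f w) z = f v} = {z | f z = f v ∧ z ≠ v} := by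
        ext z
        by_cases hz : z = v <;> simp [hz, hlab]
      rw [he]
      obtain ⟨z, hz, hzv⟩ := hne
      exact ⟨⟨z, by simp [hzv, hz]⟩, hc⟩
    by_cases hi' : i = f w
    · subst hi'
      have he : {z | Function.update f v (f w) z = f w} = insert v {z | f z = f w} := by
        ext z
        by_cases hz : z = v <;> simp [hz]
      rw [he]
      exact ⟨⟨v, by simp⟩, (hf.1 (f w)).2.insert rfl hvw⟩
    · have he : {z | Function.update f v (f w) z = i} = {z | f z = i} := by
        ext z
        by_cases hz : z = v
        · simp [hz, Ne.symm hi, Ne.symm hi']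
        · simp [hz]
      rw [he]
      obtain ⟨z, hz⟩ := (hf.1 i).1
      exact ⟨⟨z, by rw [Function.update_of_ne (by rintro rfl; exact hi hz.symm), hz]⟩, (hf.1 i).2⟩
  · have key : ∀ j, j ≠ f v → ∃ s t, G.Adj s t ∧ Function.update f v (f w) s = f v ∧
        Function.update f v (f w) t = j := by
      intro j hj
      by_cases hjw : j = f w
      · subst hjw
        obtain ⟨z, hz, hzv⟩ := hne
        obtain ⟨p, hp, q, hq, -, hqf, hpq⟩ :=
          ((hf.1 (f v)).2 (u := v) rfl (v := z) hz).exists_exit (K := {v}) rfl hzv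
        obtain rfl : p = v := hp
        have hqp : q ≠ p := hq
        exact ⟨q, p, hpq.symm, by simpa [hqp] using hqf, by simp⟩
      · obtain ⟨s, t, hst, hs, hsv, ht⟩ := hadj j hj hjw
        refine ⟨s, t, hst, by simpa [hsv] using hs, ?_⟩
        rw [Function.update_of_ne (by rintro rfl; exact hj ht.symm), ht]
    intro i j hij
    by_cases hi : i = f v
    · subst hi
      exact key j (by simpa using hij.symm)
    by_cases hj : j = f v
    · subst hj
      obtain ⟨s, t, hst, hs, ht⟩ := key i hi
      exact ⟨t, s, hst.symm, ht, hs⟩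
    · obtain ⟨s, t, hst, hs, ht⟩ := hf.2 i j hij
      refine ⟨s, t, hst, ?_, ?_⟩
      · rw [Function.update_of_ne (by rintro rfl; exact hi hs.symm), hs]
      · rw [Function.update_of_ne (by rintro rfl; exact hj ht.symm), ht]

variable [Finite V] [DecidableEq V]

/-- The branch set of `x` can be shrunk to `{x}` by giving its other vertices the label `c`, if
these vertices see the label `c` whenever they see the label `b` of the neighbour `y` of `x`. -/
lemma KConnected.shrink_branchSet [DecidableEq W] (h3 : KConnected G 3) {x y : V}
    (hxy : G.Adj x y) {a b c : W}
    (hab : a ≠ b) (hac : a ≠ c) (hbc : b ≠ c) (hl : ∀ i, i = a ∨ i = b ∨ i = c) (f : V → W)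
    (hf : IsModel G ⊤ f) (hx : f x = a) (hy : f y = b)
    (hcond : ∀ v, f v = a → v ≠ x → (∃ u, G.Adj v u ∧ f u = b) → ∃ u, G.Adj v u ∧ f u = c) :
    Relation.ReflTransGen (ModelStep G ⊤) f (fun z => if z ≠ x ∧ f z = a then c else f z) := by
  induction hn : {z | f z = a}.ncard using Nat.strong_induction_on generalizing f with
  | _ n ih =>
  by_cases hz : ∃ z, z ≠ x ∧ f z = a
  · obtain ⟨z, hzx, hza⟩ := hz
    obtain ⟨v, hv, hvx, hcv, u, hu, hvu⟩ := h3.exists_nonseparating ((isModel_iff.1 hf).1 a).2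
      (x := x) (z := z) (o := y) hx hza hzx (fun e => hab (e.symm.trans hy))
    have hva : f v = a := hv
    obtain ⟨w, hvw, hw⟩ : ∃ w, G.Adj v w ∧ f w = c := by
      rcases hl (f u) with h | h | h
      · exact absurd h hu
      · exact hcond v hv hvx ⟨u, hvu, h⟩
      · exact ⟨u, hvu, h⟩
    have hstep := hf.modelStep_update hvw (by rw [hw, hva]; exact hac.symm)
      ⟨x, by rw [hx, hva], hvx.symm⟩ (by rw [hva]; exact hcv) (fun l hlv hlw => by
        refine ⟨x, y, hxy, by rw [hx, hva], hvx.symm, ?_⟩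
        rw [hva] at hlv
        rw [hw] at hlw
        rw [hy]
        exact ((hl l).resolve_left hlv).resolve_right hlw |>.symm)
    rw [hw] at hstep
    refine .head hstep ?_
    have hyv : y ≠ v := by
      rintro rfl
      exact hab (hva.symm.trans hy)
    have he : (fun z => if z ≠ x ∧ f z = a then c else f z) =
        fun z => if z ≠ x ∧ Function.update f v c z = a then c else Function.update f v c z := by
      funext t
      by_cases ht : t = v
      · subst ht
        simp [hvx, hva]
      · simp [ht]
    rw [he]
    refine ih _ ?_ _ hstep.2.1 (by simp [hvx.symm, hx]) (by simp [hyv, hy]) ?_ rfl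
    · rw [← hn]
      refine Set.ncard_lt_ncard ⟨fun t ht => ?_, fun hc => ?_⟩ (Set.toFinite _)
      · by_cases htv : t = v
        · subst htv
          exact hva
        · simpa [htv] using ht
      · have := hc hva
        simp [hac.symm] at this
    · rintro t hta htx ⟨s, hts, hs⟩
      have htv : t ≠ v := by
        rintro rfl
        simp [hac.symm] at hta
      have hsv : s ≠ v := by
        rintro rfl
        simp [hbc.symm] at hs
      obtain ⟨r, htr, hr⟩ := hcond t (by simpa [htv] using hta) htx
        ⟨s, hts, by simpa [hsv] using hs⟩
      have hrv : r ≠ v := by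
        rintro rfl
        exact hac (hva.symm.trans hr)
      exact ⟨r, htr, by simpa [hrv] using hr⟩
  · have he : (fun z => if z ≠ x ∧ f z = a then c else f z) = f := by
      funext t
      rw [if_neg fun ht => hz ⟨t, ht⟩]
    rw [he]

/-- A branch set consisting of two pieces `A` and `B` joined only by the edge `xy` can be
reconfigured so that `x` and `y` get different labels: the vertices of `A` are relabeled one by
one, ending with `x`. -/
lemma KConnected.separate_ends (h3 : KConnected G 3) (hG : G ≤ G') {x y : V} (hxy : G'.Adj x y)
    (f : V → W) (hf : IsModel G' ⊤ f) {a : W} {l : W} (hla : l ≠ a) (hy : f y = a)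
    (A : Set V) (hx : x ∈ A) (hyA : y ∉ A) (hA : ∀ z ∈ A, f z = a) (hAc : ConnIn G A)
    (hBc : ConnIn G {z | f z = a ∧ z ∉ A})
    (hAB : ∀ u v, G.Adj u v → u ∈ A → f v = a → v ∈ A)
    (hcond : ∀ u v, G.Adj u v → u ∈ A → f v ≠ a → ∀ m, m ≠ a → m ≠ f v →
      ∃ s t, G.Adj s t ∧ f s = a ∧ s ∉ A ∧ f t = m) :
    ∃ g, IsModel G' ⊤ g ∧ Relation.ReflTransGen (ModelStep G' ⊤) f g ∧ g x ≠ g y := by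
  induction hn : A.ncard using Nat.strong_induction_on generalizing f A with
  | _ n ih =>
  obtain ⟨o, ho⟩ := ((isModel_iff.1 hf).1 l).1
  have hoA : o ∉ A := fun h => hla (ho.symm.trans (hA o h))
  by_cases hz : ∃ z, z ∈ A ∧ z ≠ x
  · obtain ⟨z, hzA, hzx⟩ := hz
    obtain ⟨v, hv, hvx, hcv, w, hwA, hvw⟩ := h3.exists_nonseparating hAc hx hzA hzx hoA
    have hva : f v = a := hA v hv
    have hwa : f w ≠ a := fun h => hwA (hAB v w hvw hv h)
    have hyv : y ≠ v := by
      rintro rfl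
      exact hyA hv
    have hrest : ConnIn G' {z | f z = a ∧ z ≠ v} := by
      apply ConnIn.of_forall_reachIn (x := x)
      rintro t ⟨hta, htv⟩
      by_cases htA : t ∈ A
      · exact (hcv (u := x) ⟨hx, hvx.symm⟩ (v := t) ⟨htA, htv⟩).mono hG
          fun s hs => ⟨hA s hs.1, hs.2⟩
      · refine (ReachIn.of_adj (S := {z | f z = a ∧ z ≠ v}) ⟨hA x hx, hvx.symm⟩ ⟨hy, hyv⟩
          hxy).trans ?_
        exact (hBc (u := y) ⟨hy, hyA⟩ (v := t) ⟨hta, htA⟩).mono hG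
          fun s hs => ⟨hs.1, by rintro rfl; exact hs.2 hv⟩
    have hstep := hf.modelStep_update (hG hvw) (by rwa [hva])
      ⟨x, by rw [hA x hx, hva], hvx.symm⟩ (by rwa [hva]) (fun m hmv hmw => by
        rw [hva] at hmv ⊢
        obtain ⟨s, t, hst, hs, hsA, ht⟩ := hcond v w hvw hv hwa m hmv hmw
        exact ⟨s, t, hG hst, hs, by rintro rfl; exact hsA hv, ht⟩)
    have hupd : ∀ t, Function.update f v (f w) t = a ↔ f t = a ∧ t ≠ v := by
      intro t
      by_cases htv : t = v <;> simp [htv, hwa]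
    have hbr : ∀ t, (Function.update f v (f w) t = a ∧ t ∉ A \ {v}) ↔ (f t = a ∧ t ∉ A) := by
      intro t
      rw [hupd]
      constructor
      · rintro ⟨⟨h1, h2⟩, h3⟩
        exact ⟨h1, fun h => h3 ⟨h, h2⟩⟩
      · rintro ⟨h1, h2⟩
        exact ⟨⟨h1, by rintro rfl; exact h2 hv⟩, fun h => h2 h.1⟩
    have hkeep : ∀ t, f t ≠ a → Function.update f v (f w) t = f t := fun t ht =>
      Function.update_of_ne (by rintro rfl; exact ht hva) _ _
    obtain ⟨g, hg, hreach, hne⟩ := ih _ (by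
        rw [← hn]
        exact Set.ncard_sdiff_singleton_lt_of_mem hv) _ hstep.2.1
      ((hupd y).2 ⟨hy, hyv⟩) (A \ {v}) ⟨hx, hvx.symm⟩ (fun h => hyA h.1)
      (fun t ht => (hupd t).2 ⟨hA t ht.1, ht.2⟩) hcv (by simpa only [hbr] using hBc)
      (fun s t hst hs ht => ⟨hAB s t hst hs.1 ((hupd t).1 ht).1, ((hupd t).1 ht).2⟩)
      (by
        intro s t hst hs ht m hma hmt
        have : ∃ s t, G.Adj s t ∧ f s = a ∧ s ∉ A ∧ f t = m := by
          by_cases htv : t = v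
          · subst htv
            exact hcond t w hvw hv hwa m hma (by simpa using hmt)
          · rw [Function.update_of_ne htv] at ht hmt
            exact hcond s t hst hs.1 ht m hma hmt
        obtain ⟨s, t, hst, hs, hsA, ht⟩ := this
        refine ⟨s, t, hst, ((hbr s).2 ⟨hs, hsA⟩).1, ((hbr s).2 ⟨hs, hsA⟩).2, ?_⟩
        rw [hkeep t (by rwa [ht]), ht]) rfl
    exact ⟨g, hg, .head hstep hreach, hne⟩
  · have hAx : ∀ t ∈ A, t = x := fun t ht => by
      by_contra htx
      exact hz ⟨t, ht, htx⟩
    obtain ⟨p, hp, w, hwA, -, -, hxw⟩ := (h3.reachIn_compl (N := ∅) (by simp)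
      (u := x) (v := o) (by simp) (by simp)).exists_exit hx hoA
    obtain rfl : p = x := hAx p hp
    have hxa : f p = a := hA p hx
    have hwa : f w ≠ a := fun h => hwA (hAB p w hxw hp h)
    have hyx : y ≠ p := hxy.ne'
    have hBe : {z | f z = a ∧ z ≠ p} = {z | f z = a ∧ z ∉ A} := by
      ext t
      exact and_congr_right fun _ => not_congr ⟨fun h => h ▸ hp, hAx t⟩
    have hstep := hf.modelStep_update (hG hxw) (by rwa [hxa]) ⟨y, by rw [hy, hxa], hyx⟩
      (by rw [hxa, hBe]; exact hBc.mono hG) (fun m hmv hmw => by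
        rw [hxa] at hmv ⊢
        obtain ⟨s, t, hst, hs, hsA, ht⟩ := hcond p w hxw hp hwa m hmv hmw
        exact ⟨s, t, hG hst, hs, by rintro rfl; exact hsA hp, ht⟩)
    exact ⟨_, hstep.2.1, .single hstep, by simpa [hyx, hy] using hwa⟩

end Reconfiguration

section AddEdge

variable {V : Type*} {G : SimpleGraph V} {x y : V}

lemma sup_fromEdgeSet_pair_adj {u v : V} (hxy : x ≠ y) :
    (G ⊔ SimpleGraph.fromEdgeSet {s(x, y)}).Adj u v ↔
      G.Adj u v ∨ (u = x ∧ v = y) ∨ (u = y ∧ v = x) := by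
  simp only [SimpleGraph.sup_adj, SimpleGraph.fromEdgeSet_adj, Set.mem_singleton_iff, Sym2.eq_iff]
  constructor
  · tauto
  · rintro (h | ⟨rfl, rfl⟩ | ⟨rfl, rfl⟩)
    · exact Or.inl h
    · exact Or.inr ⟨by simp, hxy⟩
    · exact Or.inr ⟨by simp, hxy.symm⟩

/-- A walk may be assumed to use the added edge `xy` at most once. -/
lemma ReachIn.of_sup_fromEdgeSet (hxy : x ≠ y) {S : Set V} {u v : V}
    (h : ReachIn (G ⊔ SimpleGraph.fromEdgeSet {s(x, y)}) S u v) :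
    ReachIn G S u v ∨ (ReachIn G S u x ∧ ReachIn G S y v) ∨
      (ReachIn G S u y ∧ ReachIn G S x v) := by
  obtain ⟨p, hp⟩ := h
  induction p with
  | nil => exact Or.inl (ReachIn.refl (hp _ (by simp)))
  | @cons a b c hab p ih =>
    have ha : a ∈ S := hp a (by simp)
    have hb : b ∈ S := hp b (by simp)
    have ih := ih fun z hz => hp z (by simp [hz])
    rcases (sup_fromEdgeSet_pair_adj hxy).1 hab with h | ⟨rfl, rfl⟩ | ⟨rfl, rfl⟩
    · have h := ReachIn.of_adj ha hb h
      rcases ih with h' | ⟨h', h''⟩ | ⟨h', h''⟩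
      exacts [Or.inl (h.trans h'), Or.inr (Or.inl ⟨h.trans h', h''⟩),
        Or.inr (Or.inr ⟨h.trans h', h''⟩)]
    · rcases ih with h' | ⟨h', h''⟩ | ⟨h', h''⟩
      exacts [Or.inr (Or.inl ⟨ReachIn.refl ha, h'⟩), Or.inr (Or.inl ⟨ReachIn.refl ha, h''⟩),
        Or.inl h'']
    · rcases ih with h' | ⟨h', h''⟩ | ⟨h', h''⟩
      exacts [Or.inr (Or.inr ⟨ReachIn.refl ha, h'⟩), Or.inl h'',
        Or.inr (Or.inr ⟨ReachIn.refl ha, h''⟩)]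

lemma isModel_of_sup_fromEdgeSet {W : Type*} (hxy : x ≠ y) {f : V → W}
    (hf : IsModel (G ⊔ SimpleGraph.fromEdgeSet {s(x, y)}) ⊤ f)
    (hsame : f x = f y → ConnIn G {z | f z = f x})
    (hdiff : f x ≠ f y → ∃ u v, G.Adj u v ∧ f u = f x ∧ f v = f y) : IsModel G ⊤ f := by
  rw [isModel_iff] at hf ⊢
  refine ⟨fun i => ⟨(hf.1 i).1, ?_⟩, fun i j hij => ?_⟩
  · by_cases h : f x = i ∧ f y = i
    · obtain ⟨rfl, h⟩ := h
      exact hsame h.symm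
    · intro u hu v hv
      rcases ((hf.1 i).2 hu hv).of_sup_fromEdgeSet hxy with h' | ⟨h', h''⟩ | ⟨h', h''⟩
      exacts [h', absurd ⟨h'.right_mem, h''.left_mem⟩ h, absurd ⟨h''.left_mem, h'.right_mem⟩ h]
  · obtain ⟨u, v, huv, rfl, rfl⟩ := hf.2 i j hij
    rcases (sup_fromEdgeSet_pair_adj hxy).1 huv with h | ⟨rfl, rfl⟩ | ⟨rfl, rfl⟩
    · exact ⟨u, v, h, rfl, rfl⟩
    · exact hdiff hij
    · obtain ⟨u, v, huv, hu, hv⟩ := hdiff hij.symm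
      exact ⟨v, u, huv.symm, hv, hu⟩

lemma IsModel.of_reflTransGen {W : Type*} {H : SimpleGraph W} {f g : V → W} (hf : IsModel G H f)
    (h : Relation.ReflTransGen (ModelStep G H) f g) : IsModel G H g := by
  induction h with
  | refl => exact hf
  | tail _ h _ => exact h.2.1

/-- The model given by a nonseparating induced path from `x` to `y`: the vertex `y` is labeled
`b`, the rest of the path `a`, and the complement of the path `c`. -/
lemma KConnected.exists_path_model [Finite V] (h3 : KConnected G 3) (hxy : x ≠ y) {z : V}
    (hzx : z ≠ x) (hzy : z ≠ y) {W : Type*} {a b c : W} (hab : a ≠ b) (hac : a ≠ c) (hbc : b ≠ c)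
    (hl : ∀ i, i = a ∨ i = b ∨ i = c) :
    ∃ t : V → W, IsModel G ⊤ t ∧ t x = a ∧ t y = b ∧ (∀ v, v ≠ y → t v ≠ b) ∧
      ∀ v, t v = a → ∃ u, G.Adj v u ∧ t u = c := by
  classical
  obtain ⟨D, ⟨d, hd⟩, hDc, hDxy, hdom, hsep⟩ := h3.exists_nonseparating_path hzx hzy
  have hxD : x ∉ D := hDxy.left_mem
  have hyD : y ∉ D := hDxy.right_mem
  let t : V → W := fun z => if z ∈ D then c else if z = y then b else a
  have htc : ∀ z, t z = c ↔ z ∈ D := by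
    intro z
    by_cases hz : z ∈ D <;> by_cases hzy : z = y <;> simp [t, hz, hzy, hyD, hac, hbc]
  have htb : ∀ z, t z = b ↔ z = y := by
    intro z
    by_cases hz : z = y
    · simp [t, hz, hyD]
    · by_cases hzD : z ∈ D <;> simp [t, hz, hzD, hbc.symm, hab]
  have hta : ∀ z, t z = a ↔ z ∉ D ∧ z ≠ y := by
    intro z
    by_cases hz : z = y
    · simp [t, hz, hyD, hab.symm]
    · by_cases hzD : z ∈ D <;> simp [t, hz, hzD, hac.symm]
  have htA : ∀ v, t v = a → ∃ u, G.Adj v u ∧ t u = c := fun v hv => by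
    obtain ⟨u, hu, hvu⟩ := hdom v ((hta v).1 hv).1
    exact ⟨u, hvu, (htc u).2 hu⟩
  have htx : t x = a := (hta x).2 ⟨hxD, hxy⟩
  have hty : t y = b := (htb y).2 rfl
  have hEab : ∃ u v, G.Adj u v ∧ t u = a ∧ t v = b := by
    obtain ⟨p, hp, q, hq, hpD, -, hpq⟩ := hDxy.exists_exit (K := {y}ᶜ) hxy (by simp)
    exact ⟨p, q, hpq, (hta p).2 ⟨hpD, hp⟩, (htb q).2 (by simpa using hq)⟩
  have hEac : ∃ u v, G.Adj u v ∧ t u = a ∧ t v = c := by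
    obtain ⟨u, h, hu⟩ := htA x htx
    exact ⟨x, u, h, htx, hu⟩
  have hEbc : ∃ u v, G.Adj u v ∧ t u = b ∧ t v = c := by
    obtain ⟨u, hu, hvu⟩ := hdom y hyD
    exact ⟨y, u, hvu, hty, (htc u).2 hu⟩
  have hsymm : ∀ {i j}, (∃ u v, G.Adj u v ∧ t u = i ∧ t v = j) →
      ∃ u v, G.Adj u v ∧ t u = j ∧ t v = i :=
    fun ⟨u, v, h, hu, hv⟩ => ⟨v, u, h.symm, hv, hu⟩
  refine ⟨t, isModel_iff.2 ⟨fun i => ?_, fun i j hij => ?_⟩, htx, hty,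
    fun v hv h => hv ((htb v).1 h), htA⟩
  · rcases hl i with rfl | rfl | rfl
    · refine ⟨⟨x, htx⟩, ConnIn.of_forall_reachIn (x := x) fun z hz => ?_⟩
      obtain ⟨hzD, hzy⟩ := (hta z).1 hz
      obtain ⟨P, hP⟩ := hDxy
      have hP' : ∀ s ∈ P.bypass.support, s ∉ D := fun s hs =>
        hP s (P.support_bypass_subset_support hs)
      have hzP := hsep z hzD P.bypass hP'
      refine ⟨P.bypass.takeUntil z hzP, fun s hs => (hta s).2
        ⟨hP' s (P.bypass.support_takeUntil_subset_support hzP hs), ?_⟩⟩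
      rintro rfl
      exact SimpleGraph.Walk.endpoint_notMem_support_takeUntil P.bypass_isPath hzP hzy.symm hs
    · refine ⟨⟨y, hty⟩, fun u hu v hv => ?_⟩
      obtain rfl := (htb u).1 hu
      obtain rfl := (htb v).1 hv
      exact ReachIn.refl hu
    · simp only [htc]
      exact ⟨⟨d, hd⟩, hDc⟩
  · rcases hl i with rfl | rfl | rfl <;> rcases hl j with rfl | rfl | rfl
    exacts [absurd rfl hij, hEab, hEac, hsymm hEab, absurd rfl hij, hEbc, hsymm hEac, hsymm hEbc,
      absurd rfl hij]

/-- A model of `G + xy` in which `x` and `y` have different labels reaches a model of `G`. -/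
lemma KConnected.exists_reach_of_ne [Finite V] (h3 : KConnected G 3) (hxy : x ≠ y)
    {f : V → Fin 3} (hf : IsModel (G ⊔ SimpleGraph.fromEdgeSet {s(x, y)}) ⊤ f)
    (hne : f x ≠ f y) :
    ∃ g, IsModel G ⊤ g ∧
      Relation.ReflTransGen (ModelStep (G ⊔ SimpleGraph.fromEdgeSet {s(x, y)}) ⊤) f g := by
  classical
  by_cases hedge : ∃ u v, G.Adj u v ∧ f u = f x ∧ f v = f y
  · exact ⟨f, isModel_of_sup_fromEdgeSet hxy hf (fun h => absurd h hne) fun _ => hedge, .refl⟩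
  obtain ⟨c, hac, hbc, hl⟩ : ∃ c, f x ≠ c ∧ f y ≠ c ∧ ∀ i, i = f x ∨ i = f y ∨ i = c := by
    generalize f x = a at hne
    generalize f y = b at hne
    revert a b
    decide
  have h3' : KConnected (G ⊔ SimpleGraph.fromEdgeSet {s(x, y)}) 3 := h3.mono le_sup_left
  have hadj : (G ⊔ SimpleGraph.fromEdgeSet {s(x, y)}).Adj x y :=
    (sup_fromEdgeSet_pair_adj hxy).2 (by simp)
  have hreach₁ := h3'.shrink_branchSet hadj hne hac hbc hl f hf rfl rfl (by
    rintro v hv hvx ⟨u, hvu, hu⟩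
    rcases (sup_fromEdgeSet_pair_adj hxy).1 hvu with h | ⟨rfl, -⟩ | ⟨rfl, -⟩
    exacts [absurd ⟨v, u, h, hv, hu⟩ hedge, absurd rfl hvx, absurd hv.symm hne])
  have hg := hf.of_reflTransGen hreach₁
  have hreach₂ := h3'.shrink_branchSet hadj.symm hne.symm hbc hac
    (fun i => or_left_comm.1 (hl i)) _ hg (by simp [hne.symm]) (by simp) (by
      rintro v hv hvy ⟨u, hvu, hu⟩
      have hvx : v ≠ x := by
        rintro rfl
        simp [hne] at hv
      have hux : u = x := by
        by_contra hux
        by_cases hfu : f u = f x <;> simp [hux, hfu, hac.symm] at hu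
      have hfv : f v = f y := by
        by_cases hfv : f v = f x
        · simp [hvx, hfv, hbc.symm] at hv
        · simpa [hfv] using hv
      subst hux
      rcases (sup_fromEdgeSet_pair_adj hxy).1 hvu with h | ⟨rfl, -⟩ | ⟨rfl, -⟩
      exacts [absurd ⟨u, v, h.symm, rfl, hfv⟩ hedge, absurd rfl hvx, absurd rfl hvy])
  obtain ⟨z, hz⟩ := ((isModel_iff.1 hf).1 c).1
  obtain ⟨t, ht, htx, hty, htb, htA⟩ := h3.exists_path_model hxy (z := z)
    (by rintro rfl; exact hac hz) (by rintro rfl; exact hbc hz) hne hac hbc hl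
  have hreach₃ := h3'.shrink_branchSet hadj hne hac hbc hl t (ht.mono le_sup_left) htx hty
    fun v hv _ _ => (htA v hv).imp fun u hu => ⟨Or.inl hu.1, hu.2⟩
  refine ⟨t, ht, (hreach₁.trans hreach₂).trans (reflTransGen_modelStep_symm ?_)⟩
  convert hreach₃ using 1
  funext v
  by_cases hvx : v = x
  · subst hvx
    simp [hne, htx]
  by_cases hvy : v = y
  · subst hvy
    simp [hne.symm, hty]
  · have h1 := hl (f v)
    have h2 := hl (t v)
    have h3 := htb v hvy
    grind

/-- A model of `G + xy` in which `x` and `y` have the same label is a model of `G`, or reaches a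
model in which they have different labels. -/
lemma KConnected.exists_reach_ne [Finite V] (h3 : KConnected G 3) (hxy : x ≠ y)
    {f : V → Fin 3} (hf : IsModel (G ⊔ SimpleGraph.fromEdgeSet {s(x, y)}) ⊤ f)
    (hfxy : f x = f y) (hfG : ¬ IsModel G ⊤ f) :
    ∃ g, IsModel (G ⊔ SimpleGraph.fromEdgeSet {s(x, y)}) ⊤ g ∧
      Relation.ReflTransGen (ModelStep (G ⊔ SimpleGraph.fromEdgeSet {s(x, y)}) ⊤) f g ∧
      g x ≠ g y := by
  classical
  have hadj : (G ⊔ SimpleGraph.fromEdgeSet {s(x, y)}).Adj x y :=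
    (sup_fromEdgeSet_pair_adj hxy).2 (by simp)
  obtain ⟨a, hx⟩ : ∃ a, f x = a := ⟨_, rfl⟩
  have hy : f y = a := hfxy.symm.trans hx
  obtain ⟨l, hla⟩ : ∃ l, l ≠ a := exists_ne a
  let S : Set V := {z | f z = a}
  let A : Set V := {z | ReachIn G S x z}
  let B : Set V := {z | ReachIn G S y z}
  have hxS : x ∈ S := hx
  have hyS : y ∈ S := hy
  have hcover : ∀ z, f z = a → z ∈ A ∨ z ∈ B := by
    intro z hz
    rcases (((isModel_iff.1 hf).1 a).2 hx hz).of_sup_fromEdgeSet hxy with h | ⟨-, h⟩ | ⟨-, h⟩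
    exacts [Or.inl h, Or.inr h, Or.inl h]
  have hxy' : ¬ ReachIn G S x y := by
    intro hc
    refine hfG (isModel_of_sup_fromEdgeSet hxy hf (fun _ => ?_) fun h => absurd hfxy h)
    rw [hx]
    apply ConnIn.of_forall_reachIn (x := x)
    intro z hz
    rcases hcover z hz with h | h
    exacts [h, hc.trans h]
  have hdisj : ∀ z, z ∈ A → z ∉ B := fun z hA hB => hxy' (ReachIn.trans hA (ReachIn.symm hB))
  have hA : ∀ z ∈ A, f z = a := fun z (hz : ReachIn G S x z) => hz.right_mem
  have hB : ∀ z ∈ B, f z = a := fun z (hz : ReachIn G S y z) => hz.right_mem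
  have hAB : ∀ z, f z = a ∧ z ∉ A ↔ z ∈ B := fun z =>
    ⟨fun h => (hcover z h.1).resolve_left h.2, fun h => ⟨hB z h, fun h' => hdisj z h' h⟩⟩
  have hBA : ∀ z, f z = a ∧ z ∉ B ↔ z ∈ A := fun z =>
    ⟨fun h => (hcover z h.1).resolve_right h.2, fun h => ⟨hA z h, hdisj z h⟩⟩
  by_cases hall : ∀ m, m ≠ a → ∃ s t, G.Adj s t ∧ s ∈ B ∧ f t = m
  · refine h3.separate_ends le_sup_left hadj f hf hla hy A (ReachIn.refl hxS) hxy' hA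
      (connIn_component x) (by simp only [hAB]; exact connIn_component y)
      (fun u v huv hu hv => ReachIn.trans hu (ReachIn.of_adj (hA u hu) hv huv)) ?_
    intro u v _ _ _ m hm _
    obtain ⟨s, t, hst, hs, ht⟩ := hall m hm
    exact ⟨s, t, hst, hB s hs, ((hAB s).2 hs).2, ht⟩
  · push Not at hall
    obtain ⟨m₀, hm₀, hno⟩ := hall
    obtain ⟨g, hg, hr, hne⟩ := h3.separate_ends le_sup_left hadj.symm f hf hla hx B
      (ReachIn.refl hyS) (fun h => hxy' (ReachIn.symm h)) hB
      (connIn_component y) (by simp only [hBA]; exact connIn_component x)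
      (fun u v huv hu hv => ReachIn.trans hu (ReachIn.of_adj (hB u hu) hv huv)) (by
        intro u v huv hu hv m hma hmv
        have hvm₀ : f v ≠ m₀ := hno u v huv hu
        obtain rfl : m = m₀ := by omega
        obtain ⟨s, t, hst, hs, ht⟩ := (isModel_iff.1 hf).2 a m hma.symm
        rcases (sup_fromEdgeSet_pair_adj hxy).1 hst with h | ⟨rfl, rfl⟩ | ⟨rfl, rfl⟩
        · refine ⟨s, t, h, hs, fun hsB => hno s t h hsB ht, ht⟩
        · exact absurd (ht.symm.trans hy) hma
        · exact absurd (ht.symm.trans hx) hma)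
    exact ⟨g, hg, hr, hne.symm⟩

end AddEdge

/-- if `G` is 3-connected and `G ∈ host(K₃)`, then the graph `G'` obtained
from `G` by adding an edge between two non-adjacent vertices `x` and `y` is in
`host(K₃)`. -/
theorem stmt18 {V : Type} [Fintype V] [DecidableEq V] (G : SimpleGraph V)
    (h3 : KConnected G 3) (hG : InHost G (⊤ : SimpleGraph (Fin 3)))
    (x y : V) (hxy : x ≠ y) (hnadj : ¬ G.Adj x y) :
    InHost (G ⊔ SimpleGraph.fromEdgeSet {s(x, y)}) (⊤ : SimpleGraph (Fin 3)) := by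
  have hreach : ∀ f, IsModel (G ⊔ SimpleGraph.fromEdgeSet {s(x, y)}) (⊤ : SimpleGraph (Fin 3)) f →
      ∃ g, IsModel G ⊤ g ∧
        Relation.ReflTransGen (ModelStep (G ⊔ SimpleGraph.fromEdgeSet {s(x, y)}) ⊤) f g := by
    intro f hf
    by_cases hfG : IsModel G ⊤ f
    · exact ⟨f, hfG, .refl⟩
    by_cases hfxy : f x = f y
    · obtain ⟨g, hg, hfg, hne⟩ := h3.exists_reach_ne hxy hf hfxy hfG
      obtain ⟨g', hg', hgg'⟩ := h3.exists_reach_of_ne hxy hg hne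
      exact ⟨g', hg', hfg.trans hgg'⟩
    · exact h3.exists_reach_of_ne hxy hf hfxy
  refine ⟨hG.1.imp fun f hf => hf.mono le_sup_left, fun f g hf hg => ?_⟩
  obtain ⟨f', hf', hff'⟩ := hreach f hf
  obtain ⟨g', hg', hgg'⟩ := hreach g hg
  exact (hff'.trans (Relation.ReflTransGen.mono (fun _ _ => ModelStep.mono le_sup_left) _ _
    (hG.2 f' g' hf' hg'))).trans
    (reflTransGen_modelStep_symm hgg')
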